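/- A proxet A has all suprema if and only if it has all infima: if every lower vector on A has a supremum in A, then every upper vector on A has an infimum in A, and conversely. -/

import Mathlib

/-- A proximity set (proxet): a set with a proximity map `d : A × A → [0,1]`
that is reflexive, transitive (w.r.t. multiplication) and antisymmetric. -/
class Proxet (A : Type*) where
  d : A → A → ℝ
  d_nonneg : ∀ x y : A, 0 ≤ d x y
  d_le_one : ∀ x y : A, d x y ≤ 1
  d_refl : ∀ x : A, d x x = 1
  d_trans : ∀ x y z : A, d x y * d y z ≤ d x z
  d_antisymm : ∀ x y : A, d x y = 1 → d y x = 1 → x = y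

open Proxet

/-- Residuation on `[0,1]`: `r ⊢ s = 1` if `r ≤ s`, else `s / r`. -/
noncomputable def resid (r s : ℝ) : ℝ := if r ≤ s then 1 else s / r

/-- A lower vector on a proxet `A`: a map `λ : A → [0,1]` with `d(x,y)·λ(y) ≤ λ(x)`. -/
def IsLowerVector (A : Type*) [Proxet A] (lam : A → ℝ) : Prop :=
  (∀ x : A, 0 ≤ lam x ∧ lam x ≤ 1) ∧ ∀ x y : A, d x y * lam y ≤ lam x

/-- An upper vector on a proxet `A`: a map `υ : A → [0,1]` with `υ(x)·d(x,y) ≤ υ(y)`. -/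
def IsUpperVector (A : Type*) [Proxet A] (u : A → ℝ) : Prop :=
  (∀ x : A, 0 ≤ u x ∧ u x ≤ 1) ∧ ∀ x y : A, u x * d x y ≤ u y

/-- `s` is a supremum of the lower vector `lam`. -/
def IsSupremum (A : Type*) [Proxet A] (lam : A → ℝ) (s : A) : Prop :=
  ∀ y : A, d s y = ⨅ x : A, resid (lam x) (d x y)

/-- `m` is an infimum of the upper vector `u`. -/
def IsInfimum (A : Type*) [Proxet A] (u : A → ℝ) (m : A) : Prop :=
  ∀ x : A, d x m = ⨅ y : A, resid (u y) (d x y)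

theorem le_resid_iff {a r s : ℝ} (ha : a ≤ 1) (hr : 0 ≤ r) (hs : 0 ≤ s) :
    a ≤ resid r s ↔ r * a ≤ s := by
  unfold resid
  split_ifs with h
  · exact iff_of_true ha ((mul_le_of_le_one_right hr ha).trans h)
  · rw [le_div_iff₀ (hs.trans_lt (not_le.mp h)), mul_comm]

theorem resid_nonneg {r s : ℝ} (hr : 0 ≤ r) (hs : 0 ≤ s) : 0 ≤ resid r s :=
  (le_resid_iff zero_le_one hr hs).mpr (by simpa using hs)

theorem resid_le_one {r s : ℝ} (hr : 0 ≤ r) : resid r s ≤ 1 := by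
  unfold resid
  split_ifs with h
  · exact le_rfl
  · exact div_le_one_of_le₀ (not_le.mp h).le hr

theorem bddBelow_range_resid {ι : Type*} {f g : ι → ℝ} (hf : ∀ i, 0 ≤ f i) (hg : ∀ i, 0 ≤ g i) :
    BddBelow (Set.range fun i => resid (f i) (g i)) :=
  ⟨0, by rintro _ ⟨i, rfl⟩; exact resid_nonneg (hf i) (hg i)⟩

theorem le_iInf_resid_iff {ι : Type*} [Nonempty ι] {f g : ι → ℝ} {a : ℝ} (ha : a ≤ 1)
    (hf : ∀ i, 0 ≤ f i) (hg : ∀ i, 0 ≤ g i) :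
    a ≤ ⨅ i, resid (f i) (g i) ↔ ∀ i, f i * a ≤ g i := by
  rw [le_ciInf_iff (bddBelow_range_resid hf hg)]
  exact forall_congr' fun i => le_resid_iff ha (hf i) (hg i)

theorem iInf_resid_le_one {ι : Type*} [Nonempty ι] {f g : ι → ℝ}
    (hf : ∀ i, 0 ≤ f i) (hg : ∀ i, 0 ≤ g i) : ⨅ i, resid (f i) (g i) ≤ 1 :=
  (ciInf_le (bddBelow_range_resid hf hg) (Classical.arbitrary ι)).trans (resid_le_one (hf _))

/-- The lower vector of lower bounds of an upper vector. -/
noncomputable def lowerBoundVector {A : Type*} [Proxet A] (u : A → ℝ) (x : A) : ℝ :=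
  ⨅ y : A, resid (u y) (d x y)

section LowerBoundVector

variable {A : Type*} [Proxet A] [Nonempty A] {u : A → ℝ}

theorem lowerBoundVector_le_one (hu : IsUpperVector A u) (x : A) : lowerBoundVector u x ≤ 1 :=
  iInf_resid_le_one (fun y => (hu.1 y).1) (d_nonneg x)

theorem le_lowerBoundVector_iff (hu : IsUpperVector A u) {a : ℝ} (ha : a ≤ 1) {x : A} :
    a ≤ lowerBoundVector u x ↔ ∀ y, u y * a ≤ d x y :=
  le_iInf_resid_iff ha (fun y => (hu.1 y).1) (d_nonneg x)

theorem lowerBoundVector_nonneg (hu : IsUpperVector A u) (x : A) : 0 ≤ lowerBoundVector u x :=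
  (le_lowerBoundVector_iff hu zero_le_one).mpr fun y => by simpa using d_nonneg x y

theorem mul_lowerBoundVector_le (hu : IsUpperVector A u) (x y : A) :
    u y * lowerBoundVector u x ≤ d x y :=
  (le_lowerBoundVector_iff hu (lowerBoundVector_le_one hu x)).mp le_rfl y

theorem isLowerVector_lowerBoundVector (hu : IsUpperVector A u) :
    IsLowerVector A (lowerBoundVector u) := by
  refine ⟨fun x => ⟨lowerBoundVector_nonneg hu x, lowerBoundVector_le_one hu x⟩, fun x y => ?_⟩
  refine (le_lowerBoundVector_iff hu (mul_le_one₀ (d_le_one x y)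
    (lowerBoundVector_nonneg hu y) (lowerBoundVector_le_one hu y))).mpr fun z => ?_
  calc u z * (d x y * lowerBoundVector u y) = d x y * (u z * lowerBoundVector u y) := by ring
    _ ≤ d x y * d y z :=
        mul_le_mul_of_nonneg_left (mul_lowerBoundVector_le hu y z) (d_nonneg x y)
    _ ≤ d x z := d_trans x y z

theorem IsSupremum.isInfimum (hu : IsUpperVector A u) {s : A}
    (hs : IsSupremum A (lowerBoundVector u) s) : IsInfimum A u s := by
  have le_d_iff {a : ℝ} (ha : a ≤ 1) (y : A) :
      a ≤ d s y ↔ ∀ x, lowerBoundVector u x * a ≤ d x y := by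
    rw [hs y]
    exact le_iInf_resid_iff ha (lowerBoundVector_nonneg hu) fun x => d_nonneg x y
  intro x
  refine le_antisymm ((le_lowerBoundVector_iff hu (d_le_one x s)).mpr fun y => ?_) ?_
  · have h : u y ≤ d s y := (le_d_iff (hu.1 y).2 y).mpr fun z => by
      rw [mul_comm]; exact mul_lowerBoundVector_le hu z y
    calc u y * d x s ≤ d s y * d x s := mul_le_mul_of_nonneg_right h (d_nonneg x s)
      _ = d x s * d s y := mul_comm _ _
      _ ≤ d x y := d_trans x s y
  · exact (mul_one (lowerBoundVector u x)).ge.trans ((le_d_iff le_rfl s).mp (d_refl s).ge x)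

end LowerBoundVector

theorem exists_isInfimum_of_forall_exists_isSupremum {A : Type*} [Proxet A]
    (h : ∀ lam : A → ℝ, IsLowerVector A lam → ∃ s : A, IsSupremum A lam s)
    (u : A → ℝ) (hu : IsUpperVector A u) : ∃ m : A, IsInfimum A u m := by
  obtain ⟨a, -⟩ := h 0 ⟨fun _ => by simp, fun _ _ => by simp⟩
  have : Nonempty A := ⟨a⟩
  obtain ⟨s, hs⟩ := h _ (isLowerVector_lowerBoundVector hu)
  exact ⟨s, hs.isInfimum hu⟩

/-- The opposite proxet, with `d` reversed. -/
abbrev Proxet.opposite (A : Type*) [Proxet A] : Proxet A where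
  d x y := d y x
  d_nonneg x y := d_nonneg y x
  d_le_one x y := d_le_one y x
  d_refl := d_refl
  d_trans x y z := by rw [mul_comm]; exact d_trans z y x
  d_antisymm x y hxy hyx := d_antisymm x y hyx hxy

theorem isLowerVector_opposite_iff {A : Type*} [Proxet A] {f : A → ℝ} :
    @IsLowerVector A (Proxet.opposite A) f ↔ IsUpperVector A f := by
  refine and_congr Iff.rfl (forall_comm.trans ?_)
  exact forall₂_congr fun x y => by rw [mul_comm (f x)]; exact Iff.rfl

theorem isUpperVector_opposite_iff {A : Type*} [Proxet A] {f : A → ℝ} :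
    @IsUpperVector A (Proxet.opposite A) f ↔ IsLowerVector A f :=
  (@isLowerVector_opposite_iff A (Proxet.opposite A) f).symm

/-- A proxet has all suprema if and only if it has all infima. -/
theorem stmt19 {A : Type*} [Proxet A] :
    (∀ lam : A → ℝ, IsLowerVector A lam → ∃ s : A, IsSupremum A lam s) ↔
    (∀ u : A → ℝ, IsUpperVector A u → ∃ m : A, IsInfimum A u m) := by
  refine ⟨exists_isInfimum_of_forall_exists_isSupremum, fun h lam hlam => ?_⟩
  exact @exists_isInfimum_of_forall_exists_isSupremum A (Proxet.opposite A)
    (fun u hu => h u (isLowerVector_opposite_iff.mp hu)) lam (isUpperVector_opposite_iff.mpr hlam)
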